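/- For every n ≥ 1, the set of binary sequences of length n satisfying the TGP(2) constraint is exactly the set of binary sequences of length n avoiding the forbidden blocks (011100), (001110), (001111100): B_{3;2}(n) = S_{F(2)}(n). (Theorem 8) -/

import Mathlib

/-- `x` is a ternary sequence: every entry lies in `{-1, 0, 1} ⊆ ℤ`. -/
def IsTernary {n : ℕ} (x : Fin n → ℤ) : Prop :=
  ∀ i, x i = -1 ∨ x i = 0 ∨ x i = 1

/-- A ternary sequence `x` of length `n` (0-indexed positions) satisfies the TGP(t)
constraint. -/
def SatisfiesTGPt (t : ℕ) {n : ℕ} (x : Fin n → ℤ) : Prop :=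
  ∀ k l m : Fin n, x k ≠ 0 → x k = x l → x l = x m →
    max (max |((k : ℕ) : ℤ) - ((l : ℕ) : ℤ)| |((l : ℕ) : ℤ) - ((m : ℕ) : ℤ)|)
        |((m : ℕ) : ℤ) - ((k : ℕ) : ℤ)| ≤ (t : ℤ) →
    ∀ i : Fin n, ((i : ℕ) : ℤ) = ((k : ℕ) : ℤ) + ((l : ℕ) : ℤ) - ((m : ℕ) : ℤ) →
      x i ≠ 0

/-- `B3t t n = ξ(T_{3;t}(n))`: binary sequences of length `n` obtainable as
componentwise absolute values of TGP(t)-constrained ternary sequences. -/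
def B3t (t n : ℕ) : Set (Fin n → Fin 2) :=
  {y | ∃ x : Fin n → ℤ, IsTernary x ∧ SatisfiesTGPt t x ∧
    y = fun i => if x i = 0 then 0 else 1}

/-- `y` contains the pattern `p` as a contiguous sub-block. -/
def HasBlock {n m : ℕ} (y : Fin n → Fin 2) (p : Fin m → Fin 2) : Prop :=
  ∃ i : ℕ, ∃ h : i + m ≤ n,
    ∀ j : Fin m, y ⟨i + j.val, by have := j.isLt; omega⟩ = p j

/-- `SF2 n`: binary sequences of length `n` avoiding all three forbidden blocks
`(011100)`, `(001110)`, `(001111100)` of `F(2)`. -/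
def SF2 (n : ℕ) : Set (Fin n → Fin 2) :=
  {y | ¬ HasBlock y ![0, 1, 1, 1, 0, 0] ∧ ¬ HasBlock y ![0, 0, 1, 1, 1, 0] ∧
       ¬ HasBlock y ![0, 0, 1, 1, 1, 1, 1, 0, 0]}

/-- The TGP(2) constraint only needs to be checked on pairs: if `c` is the reflection of `b`
through `a`, with `a` and `b` at distance at most two, then `x c = 0` forces `x a ≠ x b`. -/
theorem satisfiesTGPt_two_iff {n : ℕ} (x : Fin n → ℤ) :
    SatisfiesTGPt 2 x ↔ ∀ a b c : Fin n, x c = 0 → x a ≠ 0 →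
      |((a : ℕ) : ℤ) - ((b : ℕ) : ℤ)| ≤ 2 → (c : ℕ) + (b : ℕ) = 2 * (a : ℕ) → x a ≠ x b := by
  constructor
  · intro h a b c hc ha hab hcb heq
    refine h a a b ha rfl heq ?_ c (by omega) hc
    simp only [sub_self, abs_zero, Nat.cast_ofNat, sup_le_iff]
    exact ⟨⟨by norm_num, hab⟩, by rwa [abs_sub_comm]⟩
  · intro h k l m hk hkl hlm hd i hi hxi
    simp only [Nat.cast_ofNat, sup_le_iff] at hd
    obtain ⟨⟨h1, h2⟩, h3⟩ := hd
    have hne {j : Fin n} (hj : x j ≠ 0) : (i : ℕ) ≠ j := fun e => hj (Fin.ext e ▸ hxi)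
    have hik := hne hk
    have hil := hne (hkl ▸ hk)
    have him := hne (hlm ▸ hkl ▸ hk)
    have hcases : (i : ℕ) + m = 2 * (k : ℕ) ∨ (i : ℕ) + l = 2 * (k : ℕ) ∨
        (i : ℕ) + k = 2 * (l : ℕ) := by
      rw [abs_le] at h1 h2 h3
      omega
    rcases hcases with e | e | e
    · exact h k m i hxi hk (by rwa [abs_sub_comm]) e (hkl.trans hlm)
    · exact h k l i hxi hk h1 e hkl
    · exact h l k i hxi (hkl ▸ hk) (by rwa [abs_sub_comm]) e hkl.symm

section Chain

variable (D E : ℕ → Prop)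

/-- The value at `i` that makes the alternation along `E`-links starting at `i` compatible with
`D`, when the links reach at most four steps. -/
def ChainStart (i : ℕ) : Prop :=
  D i ∨ (E i ∧ E (i + 1) ∧ (D (i + 2) ∨ (E (i + 2) ∧ E (i + 3) ∧ D (i + 4))))

/-- The predicate alternating along `E`-links and restarting with `ChainStart` elsewhere. -/
def ChainAlt : ℕ → Prop
  | 0 => ChainStart D E 0
  | i + 1 => (E i ∧ ¬ ChainAlt i) ∨ (¬ E i ∧ ChainStart D E (i + 1))

variable {D E}

theorem chainAlt_of_mem (hE0 : ¬ E 0) (hE : ∀ j, E j → E (j + 2) → ¬ E (j + 4))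
    (h1 : ∀ j, E j → D j → ¬ D (j + 1))
    (h3 : ∀ j, E j → E (j + 1) → E (j + 2) → D j → ¬ D (j + 3)) {i : ℕ} (hi : D i) :
    ChainAlt D E i := by
  rcases i with _ | _ | _ | _ | _ | i
  all_goals simp only [ChainAlt, ChainStart]
  all_goals grind

end Chain

/-- There is a sequence of signs with prescribed sign changes. -/
theorem exists_sign_of_change (r : ℕ → Prop) :
    ∃ s : ℕ → Prop, ∀ j, (s (j + 1) ↔ s j) ↔ ¬ r j := by
  refine ⟨fun n => Nat.rec True (fun j p => (p ↔ ¬ r j)) n, fun j => ?_⟩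
  dsimp only
  tauto

/-- A sequence with ones `O` and zeros `Z` which avoids the three forbidden blocks has a choice of
signs that differ across every pair constrained by a zero. -/
theorem exists_signs (O Z : ℕ → Prop) (hO : ¬ O 2) (hOZ : ∀ j, O j → ¬ Z j)
    (hA : ∀ j, Z j → O (j + 1) → O (j + 2) → O (j + 3) → Z (j + 4) → ¬ Z (j + 5))
    (hB : ∀ j, Z j → Z (j + 1) → O (j + 2) → O (j + 3) → O (j + 4) → ¬ Z (j + 5))
    (hC : ∀ j, Z j → Z (j + 1) → O (j + 2) → O (j + 3) → O (j + 4) → O (j + 5) → O (j + 6) →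
      Z (j + 7) → ¬ Z (j + 8)) :
    ∃ s : ℕ → Prop,
      (∀ j, O (j + 2) → O (j + 3) → Z (j + 1) ∨ Z (j + 4) → ¬ (s (j + 3) ↔ s (j + 2))) ∧
      (∀ j, O (j + 2) → O (j + 4) → Z j ∨ Z (j + 6) → ¬ (s (j + 4) ↔ s (j + 2))) := by
  set D : ℕ → Prop := fun j => O (j + 2) ∧ O (j + 3) ∧ (Z (j + 1) ∨ Z (j + 4))
  set E : ℕ → Prop := fun j => O (j + 2) ∧ O (j + 4) ∧ (Z j ∨ Z (j + 6))
  obtain ⟨s, hs⟩ := exists_sign_of_change fun j => ChainAlt D E (j - 2)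
  have hmem {i : ℕ} (hi : D i) : ChainAlt D E i := by
    refine chainAlt_of_mem (fun h => hO h.1) ?_ ?_ ?_ hi
    · rintro j ⟨a, -, -⟩ ⟨-, -, z⟩ ⟨-, b, -⟩
      exact z.elim (hOZ _ a) (hOZ _ b)
    · rintro j ⟨a, b, z⟩ ⟨-, c, w⟩ ⟨-, -, v⟩
      have w' := w.resolve_right (hOZ _ b)
      have v' := v.resolve_left (hOZ _ a)
      exact z.elim (fun z => hB j z w' a c b v') (fun z => hA (j + 1) w' a c b v' z)
    · rintro j ⟨a, b, z⟩ ⟨c, d, -⟩ ⟨-, e, y⟩ ⟨-, -, w⟩ ⟨-, -, v⟩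
      exact hC j (z.resolve_right (hOZ _ e)) (w.resolve_right (hOZ _ b)) a c b d e
        (v.resolve_left (hOZ _ b)) (y.resolve_left (hOZ _ a))
  refine ⟨s, fun j a b z => ?_, fun j a b z => ?_⟩
  · have := hs (j + 2)
    have := hmem (i := j) ⟨a, b, z⟩
    simp_all
  · have e : E j := ⟨a, b, z⟩
    have h2 := hs (j + 2)
    have h3 := hs (j + 3)
    have hc : ChainAlt D E (j + 1) ↔ ¬ ChainAlt D E j := by
      rw [ChainAlt]
      simp only [e, true_and, not_true_eq_false, false_and, or_false]
    rw [Nat.add_sub_cancel] at h2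
    rw [show j + 3 - 2 = j + 1 by omega, hc] at h3
    clear_value D E
    grind

theorem B3t_two_subset_SF2 (n : ℕ) : B3t 2 n ⊆ SF2 n := by
  rintro _ ⟨x, hx, hT, rfl⟩
  rw [satisfiesTGPt_two_iff] at hT
  have edge (c a b : ℕ) (hc : c < n) (ha : a < n) (hb : b < n) (hxc : x ⟨c, hc⟩ = 0)
      (hxa : x ⟨a, ha⟩ ≠ 0) (hab : |(a : ℤ) - b| ≤ 2) (hr : c + b = 2 * a) :
      x ⟨a, ha⟩ ≠ x ⟨b, hb⟩ := hT ⟨a, ha⟩ ⟨b, hb⟩ ⟨c, hc⟩ hxc hxa hab hr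
  refine ⟨?_, ?_, ?_⟩
  all_goals
    rintro ⟨i, hi, h⟩
    simp [Fin.forall_fin_succ] at h
  · obtain ⟨h0, h1, h2, h3, h4, h5⟩ := h
    have e1 := edge i (i + 1) (i + 2) (by omega) (by omega) (by omega) h0 h1
      (by rw [abs_le]; omega) (by omega)
    have e2 := edge (i + 4) (i + 3) (i + 2) (by omega) (by omega) (by omega) h4 h3
      (by rw [abs_le]; omega) (by omega)
    have e3 := edge (i + 5) (i + 3) (i + 1) (by omega) (by omega) (by omega) h5 h3
      (by rw [abs_le]; omega) (by omega)
    have := hx ⟨i + 1, by omega⟩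
    have := hx ⟨i + 2, by omega⟩
    have := hx ⟨i + 3, by omega⟩
    omega
  · obtain ⟨h0, h1, h2, h3, h4, h5⟩ := h
    have e1 := edge (i + 1) (i + 2) (i + 3) (by omega) (by omega) (by omega) h1 h2
      (by rw [abs_le]; omega) (by omega)
    have e2 := edge (i + 5) (i + 4) (i + 3) (by omega) (by omega) (by omega) h5 h4
      (by rw [abs_le]; omega) (by omega)
    have e3 := edge i (i + 2) (i + 4) (by omega) (by omega) (by omega) h0 h2
      (by rw [abs_le]; omega) (by omega)
    have := hx ⟨i + 2, by omega⟩
    have := hx ⟨i + 3, by omega⟩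
    have := hx ⟨i + 4, by omega⟩
    omega
  · obtain ⟨h0, h1, h2, h3, h4, h5, h6, h7, h8⟩ := h
    have e1 := edge (i + 1) (i + 2) (i + 3) (by omega) (by omega) (by omega) h1 h2
      (by rw [abs_le]; omega) (by omega)
    have e2 := edge i (i + 2) (i + 4) (by omega) (by omega) (by omega) h0 h2
      (by rw [abs_le]; omega) (by omega)
    have e3 := edge (i + 7) (i + 6) (i + 5) (by omega) (by omega) (by omega) h7 h6
      (by rw [abs_le]; omega) (by omega)
    have e4 := edge (i + 8) (i + 6) (i + 4) (by omega) (by omega) (by omega) h8 h6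
      (by rw [abs_le]; omega) (by omega)
    have e5 := edge (i + 1) (i + 3) (i + 5) (by omega) (by omega) (by omega) h1 h3
      (by rw [abs_le]; omega) (by omega)
    have := hx ⟨i + 2, by omega⟩
    have := hx ⟨i + 3, by omega⟩
    have := hx ⟨i + 4, by omega⟩
    have := hx ⟨i + 5, by omega⟩
    have := hx ⟨i + 6, by omega⟩
    omega

theorem SF2_subset_B3t_two (n : ℕ) : SF2 n ⊆ B3t 2 n := by
  classical
  rintro y ⟨hA, hB, hC⟩
  let V (v : Fin 2) (j : ℕ) : Prop := ∃ p : Fin n, (p : ℕ) + 4 = j ∧ y p = v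
  have hV {v : Fin 2} {j i : ℕ} (h : V v j) (e : j = i + 4) : ∃ hi : i < n, y ⟨i, hi⟩ = v := by
    obtain ⟨p, hp, hv⟩ := h
    obtain rfl : (p : ℕ) = i := by omega
    exact ⟨p.isLt, hv⟩
  have hbase {v : Fin 2} {j : ℕ} (h : V v j) : ∃ i, j = i + 4 :=
    let ⟨p, hp, _⟩ := h; ⟨p, hp.symm⟩
  obtain ⟨s, hs1, hs2⟩ := exists_signs (V 1) (V 0) (by rintro ⟨p, hp, -⟩; omega)
    (by
      rintro j ⟨p, hp, hv⟩ ⟨q, hq, hw⟩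
      obtain rfl : p = q := Fin.ext (by omega)
      simp [hv] at hw)
    (by
      intro j h0 h1 h2 h3 h4 h5
      obtain ⟨i, rfl⟩ := hbase h0
      obtain ⟨_, h0⟩ := hV h0 (i := i) (by omega)
      obtain ⟨_, h1⟩ := hV h1 (i := i + 1) (by omega)
      obtain ⟨_, h2⟩ := hV h2 (i := i + 2) (by omega)
      obtain ⟨_, h3⟩ := hV h3 (i := i + 3) (by omega)
      obtain ⟨_, h4⟩ := hV h4 (i := i + 4) (by omega)
      obtain ⟨_, h5⟩ := hV h5 (i := i + 5) (by omega)
      exact hA ⟨i, by omega, by simp [Fin.forall_fin_succ, *]⟩)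
    (by
      intro j h0 h1 h2 h3 h4 h5
      obtain ⟨i, rfl⟩ := hbase h0
      obtain ⟨_, h0⟩ := hV h0 (i := i) (by omega)
      obtain ⟨_, h1⟩ := hV h1 (i := i + 1) (by omega)
      obtain ⟨_, h2⟩ := hV h2 (i := i + 2) (by omega)
      obtain ⟨_, h3⟩ := hV h3 (i := i + 3) (by omega)
      obtain ⟨_, h4⟩ := hV h4 (i := i + 4) (by omega)
      obtain ⟨_, h5⟩ := hV h5 (i := i + 5) (by omega)
      exact hB ⟨i, by omega, by simp [Fin.forall_fin_succ, *]⟩)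
    (by
      intro j h0 h1 h2 h3 h4 h5 h6 h7 h8
      obtain ⟨i, rfl⟩ := hbase h0
      obtain ⟨_, h0⟩ := hV h0 (i := i) (by omega)
      obtain ⟨_, h1⟩ := hV h1 (i := i + 1) (by omega)
      obtain ⟨_, h2⟩ := hV h2 (i := i + 2) (by omega)
      obtain ⟨_, h3⟩ := hV h3 (i := i + 3) (by omega)
      obtain ⟨_, h4⟩ := hV h4 (i := i + 4) (by omega)
      obtain ⟨_, h5⟩ := hV h5 (i := i + 5) (by omega)
      obtain ⟨_, h6⟩ := hV h6 (i := i + 6) (by omega)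
      obtain ⟨_, h7⟩ := hV h7 (i := i + 7) (by omega)
      obtain ⟨_, h8⟩ := hV h8 (i := i + 8) (by omega)
      exact hC ⟨i, by omega, by simp [Fin.forall_fin_succ, *]⟩)
  let x : Fin n → ℤ := fun p => if y p = 0 then 0 else if s (p + 4) then 1 else -1
  have hx0 (p : Fin n) : x p = 0 ↔ y p = 0 := by
    simp only [x]
    split_ifs <;> simp_all
  have hxs {p q : Fin n} (hp : y p ≠ 0) (h : x p = x q) : s (p + 4) ↔ s (q + 4) := by
    have hq : y q ≠ 0 := by rwa [Ne, ← hx0, ← h, hx0]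
    simp only [x, hp, hq, if_false] at h
    split_ifs at h <;> simp_all
  refine ⟨x, fun p => ?_, (satisfiesTGPt_two_iff x).2 ?_, ?_⟩
  · simp only [x]
    split_ifs <;> simp
  · intro a b c hc ha hab hr heq
    have hb : x b ≠ 0 := heq ▸ ha
    rw [Ne, hx0] at ha hb
    rw [hx0] at hc
    have hsab := hxs ha heq
    have hac : (a : ℕ) ≠ c := fun e => ha (Fin.ext e ▸ hc)
    have hVc : V 0 (c + 4) := ⟨c, rfl, hc⟩
    have hVa : V 1 (a + 4) := ⟨a, rfl, by omega⟩
    have hVb : V 1 (b + 4) := ⟨b, rfl, by omega⟩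
    rw [abs_le] at hab
    have hcases : (b : ℕ) = a + 1 ∨ (a : ℕ) = b + 1 ∨ (b : ℕ) = a + 2 ∨ (a : ℕ) = b + 2 := by
      omega
    rcases hcases with e | e | e | e
    · rw [e] at hsab hVb
      exact hs1 (a + 2) hVa hVb (.inl (by convert hVc using 1; omega)) hsab.symm
    · rw [e] at hsab hVa
      exact hs1 (b + 2) hVb hVa (.inr (by convert hVc using 1; omega)) hsab
    · rw [e] at hsab hVb
      exact hs2 (a + 2) hVa hVb (.inl (by convert hVc using 1; omega)) hsab.symm
    · rw [e] at hsab hVa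
      exact hs2 (b + 2) hVb hVa (.inr (by convert hVc using 1; omega)) hsab
  · funext p
    simp only [hx0]
    split_ifs with h <;> omega

/-- **Theorem 8.** For every `n ≥ 1`, the set of binary sequences of length `n`
satisfying the TGP(2) constraint is exactly the set of binary sequences of length
`n` avoiding the three forbidden blocks: `B_{3;2}(n) = S_{F(2)}(n)`. -/
theorem B32_eq_SF2 (n : ℕ) (hn : 1 ≤ n) : B3t 2 n = SF2 n := by
  exact (B3t_two_subset_SF2 n).antisymm (SF2_subset_B3t_two n)
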